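/- arXiv:2210.08606 — 3 statements merged into one kernel-verified Lean document; each statement's English description precedes it below -/
import Mathlib

section
/- Suppose the set-valued map K : ℝ^p ⇉ ℝ^n is lower semicontinuous and the map f : ℝ^p × ℝ^n × ℝ^n → ℝ^m is C-upper semicontinuous. Then the function ν(ξ,x) = sup_{z ∈ K(ξ)} dist(f(ξ,x,z), C) is lower semicontinuous on ℝ^p × ℝ^n (as a function with values in [0,+∞]). -/
/- STATEMENT 0: lower semicontinuity of ν(ξ,x) = sup_{z ∈ K(ξ)} dist(f(ξ,x,z), C). -/

open Filter Topology Metric Set Pointwise ENNReal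

noncomputable section

abbrev E (k : ℕ) := EuclideanSpace ℝ (Fin k)

/-- Lower semicontinuity of a set-valued map. -/
def SVLsc {α β : Type*} [TopologicalSpace α] [TopologicalSpace β] (K : α → Set β) : Prop :=
  ∀ ξ₀ : α, ∀ V : Set β, IsOpen V → (K ξ₀ ∩ V).Nonempty →
    ∃ U ∈ 𝓝 ξ₀, ∀ ξ ∈ U, (K ξ ∩ V).Nonempty

/-- `C`-upper semicontinuity of a map `g`. -/
def CUsc {α G : Type*} [TopologicalSpace α] [AddGroup G] [TopologicalSpace G]
    (C : Set G) (g : α → G) : Prop :=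
  ∀ x₀ : α, ∀ V ∈ 𝓝 (g x₀), ∃ U ∈ 𝓝 x₀, ∀ x ∈ U, g x ∈ V - C

/-- The auxiliary function ν, with values in `[0,+∞]`. -/
def nuF {p n m : ℕ} (f : E p → E n → E n → E m) (K : E p → Set (E n)) (C : Set (E m))
    (ξ : E p) (x : E n) : ℝ≥0∞ :=
  ⨆ z ∈ K ξ, EMetric.infEdist (f ξ x z) C

theorem add_mem_of_convex_cone {G : Type*} [AddCommGroup G] [Module ℝ G] {C : Set G}
    (hconv : Convex ℝ C) (hcone : ∀ c ∈ C, ∀ t : ℝ, 0 ≤ t → t • c ∈ C)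
    {a b : G} (ha : a ∈ C) (hb : b ∈ C) : a + b ∈ C := by
  have h := hconv (hcone a ha 2 zero_le_two) (hcone b hb 2 zero_le_two)
    (by norm_num : (0 : ℝ) ≤ 1 / 2) (by norm_num : (0 : ℝ) ≤ 1 / 2) (by norm_num)
  simpa [smul_smul] using h

/-- Subtracting an element of an additively closed set can only increase the distance to it. -/
theorem infEDist_le_infEDist_sub {G : Type*} [SeminormedAddCommGroup G] {C : Set G}
    (hadd : ∀ a ∈ C, ∀ b ∈ C, a + b ∈ C) {c : G} (hc : c ∈ C) (v : G) :
    infEDist v C ≤ infEDist (v - c) C := by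
  refine le_infEDist.2 fun y hy => (infEDist_le_edist_of_mem (hadd y hy c hc)).trans_eq ?_
  rw [edist_eq_enorm_sub, edist_eq_enorm_sub]
  congr 1
  abel

theorem CUsc.lowerSemicontinuous_infEDist {α G : Type*} [TopologicalSpace α]
    [SeminormedAddCommGroup G] {C : Set G} {g : α → G} (hg : CUsc C g)
    (hadd : ∀ a ∈ C, ∀ b ∈ C, a + b ∈ C) :
    LowerSemicontinuous fun x => infEDist (g x) C := by
  intro x₀ a ha
  obtain ⟨U, hU, h⟩ := hg x₀ {w | a < infEDist w C}
    ((isOpen_lt continuous_const continuous_infEDist).mem_nhds ha)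
  filter_upwards [hU] with x hx
  obtain ⟨v, hv, c, hc, hvc⟩ := Set.mem_sub.1 (h x hx)
  rw [← hvc]
  exact lt_of_lt_of_le hv (infEDist_le_infEDist_sub hadd hc v)

/-- The supremum of a lower semicontinuous function over a lower semicontinuous set-valued map is
lower semicontinuous. -/
theorem SVLsc.lowerSemicontinuous_iSup {α β γ δ : Type*} [TopologicalSpace α] [TopologicalSpace β]
    [TopologicalSpace γ] [CompleteLinearOrder δ] {K : α → Set γ} (hK : SVLsc K)
    {h : α × β × γ → δ} (hh : LowerSemicontinuous h) :
    LowerSemicontinuous fun q : α × β => ⨆ z ∈ K q.1, h (q.1, q.2, z) := by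
  rintro ⟨ξ₀, x₀⟩ a ha
  obtain ⟨z, hz, haz⟩ := lt_biSup_iff.1 ha
  have hev := hh (ξ₀, x₀, z) a haz
  rw [nhds_prod_eq, nhds_prod_eq] at hev
  obtain ⟨A, hA, D, hD, hAD⟩ := Filter.mem_prod_iff.1 hev
  obtain ⟨B, hB, V, hV, hBV⟩ := Filter.mem_prod_iff.1 hD
  obtain ⟨W, hWV, hWo, hzW⟩ := mem_nhds_iff.1 hV
  obtain ⟨U, hU, hKU⟩ := hK ξ₀ W hWo ⟨z, hz, hzW⟩
  filter_upwards [prod_mem_nhds (inter_mem hA hU) hB] with q hq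
  obtain ⟨y, hyK, hyW⟩ := hKU q.1 hq.1.2
  exact lt_biSup_iff.2 ⟨y, hyK, hAD ⟨hq.1.1, hBV ⟨hq.2, hWV hyW⟩⟩⟩

theorem statement0 {p n m : ℕ}
    (K : E p → Set (E n)) (C : Set (E m)) (f : E p → E n → E n → E m)
    -- standing assumptions
    (hKgraph : IsClosed {q : E p × E n | q.2 ∈ K q.1})
    (hKdom : ∀ ξ : E p, (K ξ).Nonempty)
    -- C is a nontrivial closed convex pointed cone
    (hCclosed : IsClosed C) (hCconv : Convex ℝ C)
    (hCcone : ∀ c ∈ C, ∀ t : ℝ, 0 ≤ t → t • c ∈ C)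
    (hCpointed : C ∩ (-C) = {0}) (hCnontriv : C ≠ {0})
    -- (i) K is l.s.c.
    (hKlsc : SVLsc K)
    -- (ii) f is C-u.s.c.
    (hfusc : CUsc C (fun q : E p × E n × E n => f q.1 q.2.1 q.2.2)) :
    LowerSemicontinuous (fun q : E p × E n => nuF f K C q.1 q.2) := by
  exact hKlsc.lowerSemicontinuous_iSup (hfusc.lowerSemicontinuous_infEDist
    fun _ ha _ hb => add_mem_of_convex_cone hCconv hCcone ha hb)
end
end

section
/- Suppose K : ℝ^p ⇉ ℝ^n is concave and f : ℝ^p × ℝ^n × ℝ^n → ℝ^m is C-concave. Then the function ν(ξ,x) = sup_{z ∈ K(ξ)} dist(f(ξ,x,z), C) is convex on ℝ^p × ℝ^n (as an extended-real-valued function). -/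
/- STATEMENT 3: if K is concave and f is C-concave then ν is convex
   (as an extended-real-valued function, convexity is expressed by the
   defining inequality for convex combinations). -/

open Filter Topology Metric Set Pointwise ENNReal

noncomputable section

/-- Concavity of a set-valued map. -/
def SVConcave {p n : ℕ} (K : E p → Set (E n)) : Prop :=
  ∀ ξ₁ ξ₂ : E p, ∀ t ∈ Icc (0 : ℝ) 1,
    K (t • ξ₁ + (1 - t) • ξ₂) ⊆ t • K ξ₁ + (1 - t) • K ξ₂

/-- `C`-concavity of the parametric bifunction `f` (as a map of the triple). -/
def CConcaveF {p n m : ℕ} (f : E p → E n → E n → E m) (C : Set (E m)) : Prop :=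
  ∀ (ξ₁ ξ₂ : E p) (x₁ x₂ z₁ z₂ : E n), ∀ t ∈ Icc (0 : ℝ) 1,
    f (t • ξ₁ + (1 - t) • ξ₂) (t • x₁ + (1 - t) • x₂) (t • z₁ + (1 - t) • z₂)
      - t • f ξ₁ x₁ z₁ - (1 - t) • f ξ₂ x₂ z₂ ∈ C

section InfEDist

variable {V : Type*} [SeminormedAddCommGroup V] {C : Set V}

theorem infEDist_add_le_of_add_mem (hadd : ∀ c ∈ C, ∀ d ∈ C, c + d ∈ C) (a b : V) :
    infEDist (a + b) C ≤ infEDist a C + infEDist b C := by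
  refine ENNReal.le_iInf₂_add_iInf₂ fun c hc d hd => ?_
  exact (infEDist_le_edist_of_mem (hadd c hc d hd)).trans (edist_add_add_le a b c d)

theorem infEDist_add_mem_le (hadd : ∀ c ∈ C, ∀ d ∈ C, c + d ∈ C) (a : V) {c : V} (hc : c ∈ C) :
    infEDist (a + c) C ≤ infEDist a C := by
  simpa [infEDist_zero_of_mem hc] using infEDist_add_le_of_add_mem hadd a c

theorem infEDist_smul_le_of_smul_mem [NormedSpace ℝ V] (h0 : (0 : V) ∈ C)
    (hsmul : ∀ c ∈ C, ∀ t : ℝ, 0 ≤ t → t • c ∈ C) (a : V) {t : ℝ} (ht : 0 ≤ t) :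
    infEDist (t • a) C ≤ ENNReal.ofReal t * infEDist a C := by
  rcases ht.eq_or_lt with rfl | hpos
  · simp [infEDist_zero_of_mem h0]
  have hne : ENNReal.ofReal t ≠ 0 := by simpa using hpos
  have hinf : infEDist a C = ⨅ c ∈ C, edist a c := rfl
  simp only [hinf, ENNReal.mul_iInf_of_ne hne ENNReal.ofReal_ne_top]
  refine le_iInf₂ fun c hc => (infEDist_le_edist_of_mem (hsmul c hc t ht)).trans_eq ?_
  rw [edist_smul₀, ENNReal.smul_def, smul_eq_mul, ← Real.enorm_of_nonneg ht]
  rfl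

end InfEDist

theorem Convex.add_mem_of_smul_mem {V : Type*} [AddCommGroup V] [Module ℝ V] {C : Set V}
    (hconv : Convex ℝ C) (hsmul : ∀ c ∈ C, ∀ t : ℝ, 0 ≤ t → t • c ∈ C) {c d : V}
    (hc : c ∈ C) (hd : d ∈ C) : c + d ∈ C := by
  have h := hconv (hsmul c hc 2 zero_le_two) (hsmul d hd 2 zero_le_two)
    (by norm_num : (0 : ℝ) ≤ 1 / 2) (by norm_num : (0 : ℝ) ≤ 1 / 2) (by norm_num)
  simpa [smul_smul] using h

theorem statement3 {p n m : ℕ}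
    (K : E p → Set (E n)) (C : Set (E m)) (f : E p → E n → E n → E m)
    -- standing assumptions
    (hKgraph : IsClosed {q : E p × E n | q.2 ∈ K q.1})
    (hKdom : ∀ ξ : E p, (K ξ).Nonempty)
    -- C is a nontrivial closed convex pointed cone
    (hCclosed : IsClosed C) (hCconv : Convex ℝ C)
    (hCcone : ∀ c ∈ C, ∀ t : ℝ, 0 ≤ t → t • c ∈ C)
    (hCpointed : C ∩ (-C) = {0}) (hCnontriv : C ≠ {0})
    -- (i) K is concave
    (hKconc : SVConcave K)
    -- (ii) f is C-concave
    (hfconc : CConcaveF f C) :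
    -- ν is convex on ℝ^p × ℝ^n
    ∀ (ξ₁ ξ₂ : E p) (x₁ x₂ : E n), ∀ t ∈ Icc (0 : ℝ) 1,
      nuF f K C (t • ξ₁ + (1 - t) • ξ₂) (t • x₁ + (1 - t) • x₂) ≤
        ENNReal.ofReal t * nuF f K C ξ₁ x₁ + ENNReal.ofReal (1 - t) * nuF f K C ξ₂ x₂ := by
  intro ξ₁ ξ₂ x₁ x₂ t ht
  have h0 : (0 : E m) ∈ C := (hCpointed.ge rfl).1
  have hadd : ∀ c ∈ C, ∀ d ∈ C, c + d ∈ C := fun c hc d hd =>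
    hCconv.add_mem_of_smul_mem hCcone hc hd
  refine iSup₂_le fun z hz => ?_
  obtain ⟨_, ⟨z₁, hz₁, rfl⟩, _, ⟨z₂, hz₂, rfl⟩, rfl⟩ := hKconc ξ₁ ξ₂ t ht hz
  set w := f (t • ξ₁ + (1 - t) • ξ₂) (t • x₁ + (1 - t) • x₂) (t • z₁ + (1 - t) • z₂)
  have hw : w = t • f ξ₁ x₁ z₁ + (1 - t) • f ξ₂ x₂ z₂
      + (w - t • f ξ₁ x₁ z₁ - (1 - t) • f ξ₂ x₂ z₂) := by abel
  calc infEDist w C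
      ≤ infEDist (t • f ξ₁ x₁ z₁ + (1 - t) • f ξ₂ x₂ z₂) C := by
        rw [hw]
        exact infEDist_add_mem_le hadd _ (hfconc ξ₁ ξ₂ x₁ x₂ z₁ z₂ t ht)
    _ ≤ infEDist (t • f ξ₁ x₁ z₁) C + infEDist ((1 - t) • f ξ₂ x₂ z₂) C :=
        infEDist_add_le_of_add_mem hadd _ _
    _ ≤ ENNReal.ofReal t * infEDist (f ξ₁ x₁ z₁) C
          + ENNReal.ofReal (1 - t) * infEDist (f ξ₂ x₂ z₂) C :=
        add_le_add (infEDist_smul_le_of_smul_mem h0 hCcone _ ht.1)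
          (infEDist_smul_le_of_smul_mem h0 hCcone _ (sub_nonneg.2 ht.2))
    _ ≤ ENNReal.ofReal t * nuF f K C ξ₁ x₁ + ENNReal.ofReal (1 - t) * nuF f K C ξ₂ x₂ := by
        gcongr
        · exact le_iSup₂ (f := fun z (_ : z ∈ K ξ₁) => infEDist (f ξ₁ x₁ z) C) z₁ hz₁
        · exact le_iSup₂ (f := fun z (_ : z ∈ K ξ₂) => infEDist (f ξ₂ x₂ z) C) z₂ hz₂
end
end

section
/- Suppose K : ℝ^p ⇉ ℝ^n is lower semicontinuous (with closed graph and dom K = ℝ^p). Then for every (ξ̄,x̄) ∈ ℝ^p × ℝ^n the set-valued mapping (ξ,x) ↦ Proj(x; K(ξ)) is locally bounded around (ξ̄,x̄): there exist δ₀ > 0 and R > 0 such that Proj(x; K(ξ)) ⊆ B̄(x̄, R) for all (ξ,x) ∈ B̄(ξ̄,δ₀) × B̄(x̄,δ₀). -/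
/- STATEMENT 10: if K is l.s.c. (with closed graph and full domain), then the
   projection mapping (ξ,x) ↦ Proj(x; K(ξ)) is locally bounded around every
   point (ξ̄,x̄). -/

open Filter Topology Metric Set Pointwise ENNReal

noncomputable section

/-- The (Euclidean) projection set of `x` onto `S`. -/
def projSet {X : Type*} [NormedAddCommGroup X] (x : X) (S : Set X) : Set X :=
  {s | s ∈ S ∧ dist x s = Metric.infDist x S}

theorem statement10 {p n : ℕ} (K : E p → Set (E n))
    -- standing assumptions
    (hKgraph : IsClosed {q : E p × E n | q.2 ∈ K q.1})
    (hKdom : ∀ ξ : E p, (K ξ).Nonempty)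
    -- K is l.s.c.
    (hKlsc : SVLsc K) :
    ∀ (ξ' : E p) (x' : E n), ∃ δ₀ > (0 : ℝ), ∃ R > (0 : ℝ),
      ∀ ξ ∈ Metric.closedBall ξ' δ₀, ∀ x ∈ Metric.closedBall x' δ₀,
        projSet x (K ξ) ⊆ Metric.closedBall x' R := by
  intro ξ' x'
  obtain ⟨y, hy⟩ := hKdom ξ'
  obtain ⟨U, hU, hUK⟩ := hKlsc ξ' (ball y 1) isOpen_ball ⟨y, hy, mem_ball_self one_pos⟩
  obtain ⟨δ, hδ, hδU⟩ := Metric.nhds_basis_closedBall.mem_iff.mp hU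
  refine ⟨δ, hδ, 2 * δ + dist x' y + 1, by positivity, ?_⟩
  rintro ξ hξ x hx s ⟨-, hs⟩
  obtain ⟨z, hzK, hz⟩ := hUK ξ (hδU hξ)
  have hxz : dist x s ≤ dist x z := hs ▸ Metric.infDist_le_dist_of_mem hzK
  rw [mem_closedBall] at hx ⊢
  rw [mem_ball, dist_comm] at hz
  have h₁ := dist_triangle_left s x' x
  have h₂ := dist_triangle4 x x' y z
  linarith
end
end
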